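/- arXiv:2212.02037 — 2 statements merged into one kernel-verified Lean document; each statement's English description precedes it below -/
import Mathlib

section
/- Let κ be a (k+1)-core and let u be a weak hook word such that u * κ ≠ 0 under the star action. Then the skew shape (u * κ)/κ is a ribbon (it contains no 2×2 square). -/
open scoped BigOperators Classical

noncomputable section

namespace MN

/-! ## Residues, words, canonical cyclic intervals -/

/-- The residues `ℤ/(k+1)ℤ`. -/
abbrev Idx (k : ℕ) := ZMod (k + 1)

/-- A word in the generators, recorded by its list of indices. -/
abbrev Word (k : ℕ) := List (Idx k)

/-- The support of a word. -/
def supp (k : ℕ) (u : Word k) : Finset (Idx k) := u.toFinset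

/-- The smallest `a ∈ {0,…,k}` (as a natural number) with `(a : ℤ/(k+1)) ∉ S`. -/
def gapNat (k : ℕ) (S : Finset (Idx k)) : ℕ :=
  if h : ∃ m : ℕ, m ≤ k ∧ (m : Idx k) ∉ S then Nat.find h else 0

/-- The gap element `a` of a proper subset `S`. -/
def gap (k : ℕ) (S : Finset (Idx k)) : Idx k := (gapNat k S : Idx k)

/-- Position of a residue `i` in the canonical cyclic interval
`I_S : a+1 < a+2 < ⋯ < k < 0 < ⋯ < a−1` (the gap `a` itself gets the junk position `k`). -/
def pos (k : ℕ) (S : Finset (Idx k)) (i : Idx k) : ℕ := (i - gap k S - 1).val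

/-- The list of positions of the letters of `u` in the canonical cyclic interval of its support. -/
def posList (k : ℕ) (u : Word k) : List ℕ := u.map (pos k (supp k u))

/-- A weak hook word of hook type V:
`i₁ > ⋯ > i_j < i_{j+1} < ⋯ < i_m` with respect to `I_{supp u}`. -/
def IsHookV (k : ℕ) (u : Word k) : Prop :=
  supp k u ≠ Finset.univ ∧
    ∃ (ds as : List ℕ) (v : ℕ),
      posList k u = ds ++ v :: as ∧
        List.Chain' (· > ·) (ds ++ [v]) ∧ List.Chain' (· < ·) (v :: as)

/-- A weak hook word of hook type U:
`i₁ > ⋯ > i_j = i_{j+1} < ⋯ < i_m` with respect to `I_{supp u}`. -/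
def IsHookU (k : ℕ) (u : Word k) : Prop :=
  supp k u ≠ Finset.univ ∧
    ∃ (ds as : List ℕ) (v : ℕ),
      posList k u = ds ++ v :: v :: as ∧
        List.Chain' (· > ·) (ds ++ [v]) ∧ List.Chain' (· < ·) (v :: as)

/-- A weak hook word. -/
def IsWeakHook (k : ℕ) (u : Word k) : Prop := IsHookV k u ∨ IsHookU k u

/-- The number of ascents `i_t < i_{t+1}` of a word. -/
def asc (k : ℕ) (u : Word k) : ℕ :=
  ((posList k u).zip (posList k u).tail).countP fun p => decide (p.1 < p.2)

/-- The candidates `c` in the definition of `u_min`: letters `c` of `u` for which there is a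
letter `a` of `u` with `a < c` in `I_{supp u}`, `a + 1 ≠ c`, and no letter `b` of `u` satisfies
`a < b < c`. -/
def uminCands (k : ℕ) (u : Word k) : Finset (Idx k) :=
  (supp k u).filter fun c =>
    ∃ a ∈ supp k u,
      pos k (supp k u) a < pos k (supp k u) c ∧ a + 1 ≠ c ∧
        ∀ b ∈ supp k u,
          ¬(pos k (supp k u) a < pos k (supp k u) b ∧
            pos k (supp k u) b < pos k (supp k u) c)

/-- The letter `u_min` of `u` (junk value `0` if there is no candidate). -/
def umin (k : ℕ) (u : Word k) : Idx k :=
  if h : (uminCands k u).Nonempty then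
    ((uminCands k u).exists_min_image (pos k (supp k u)) h).choose
  else 0

/-- The number of occurrences of `u_min` in `u` (`0` if there is no candidate). -/
def uminCount (k : ℕ) (u : Word k) : ℕ :=
  if (uminCands k u).Nonempty then u.count (umin k u) else 0

/-- A set of residues is `k`-connected if it is a proper subset of `{0,…,k}` which is an
interval with respect to its canonical cyclic interval order. -/
def IsKConnectedSet (k : ℕ) (S : Finset (Idx k)) : Prop :=
  S ≠ Finset.univ ∧
    ∀ i ∈ S, ∀ j ∈ S, ∀ m : Idx k,
      pos k S i ≤ pos k S m → pos k S m ≤ pos k S j → m ∈ S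

/-- A word is `k`-connected if its support is. -/
def IsKConnected (k : ℕ) (u : Word k) : Prop := IsKConnectedSet k (supp k u)

/-- A word is `k`-weak connected if `u_min` occurs `0` or `2` times in it. -/
def IsWeakConnected (k : ℕ) (u : Word k) : Prop :=
  uminCount k u = 0 ∨ uminCount k u = 2

/-- The letter `c` lies on the left side (the maximal strictly decreasing initial segment) of
the hook form of `u`: equivalently, it occurs in some strictly decreasing initial segment. -/
def OnLeftSide (k : ℕ) (u : Word k) (c : Idx k) : Prop :=
  ∃ p q : Word k, u = p ++ q ∧
    List.Chain' (fun a b => pos k (supp k u) b < pos k (supp k u) a) p ∧ c ∈ p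

/-- The letter `c` lies on the right side (the maximal strictly increasing final segment) of
the hook form of `u`. -/
def OnRightSide (k : ℕ) (u : Word k) (c : Idx k) : Prop :=
  ∃ p q : Word k, u = p ++ q ∧
    List.Chain' (fun a b => pos k (supp k u) a < pos k (supp k u) b) q ∧ c ∈ q

/-! ## The sets `X^r_i` and their refinements (indexed by `i : ℤ`, empty for `i < 0`) -/

/-- `V^r_i`: weak hook words of hook type V, weak length `r`, `asc = i`. -/
def VSet (k r : ℕ) (i : ℤ) : Set (Word k) :=
  {u | IsHookV k u ∧ u.length = r ∧ (asc k u : ℤ) = i}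

/-- `U^r_i`. -/
def USet (k r : ℕ) (i : ℤ) : Set (Word k) :=
  {u | IsHookU k u ∧ u.length = r ∧ (asc k u : ℤ) = i}

/-- `V^r_{i,wc}`: the `k`-weak connected members of `V^r_i`. -/
def VSetWC (k r : ℕ) (i : ℤ) : Set (Word k) := {u ∈ VSet k r i | IsWeakConnected k u}

/-- `U^r_{i,wc}`. -/
def USetWC (k r : ℕ) (i : ℤ) : Set (Word k) := {u ∈ USet k r i | IsWeakConnected k u}

/-- `V^r_{i,c}`: the `k`-connected members of `V^r_i`. -/
def VSetC (k r : ℕ) (i : ℤ) : Set (Word k) := {u ∈ VSet k r i | IsKConnected k u}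

/-- `V^r_{i,w̄c,left}`. -/
def VSetNWCL (k r : ℕ) (i : ℤ) : Set (Word k) :=
  {u ∈ VSet k r i | ¬IsWeakConnected k u ∧ OnLeftSide k u (umin k u)}

/-- `V^r_{i,w̄c,right}`. -/
def VSetNWCR (k r : ℕ) (i : ℤ) : Set (Word k) :=
  {u ∈ VSet k r i | ¬IsWeakConnected k u ∧ OnRightSide k u (umin k u)}

/-- `U^r_{i,w̄c,left}`. -/
def USetNWCL (k r : ℕ) (i : ℤ) : Set (Word k) :=
  {u ∈ USet k r i | ¬IsWeakConnected k u ∧ OnLeftSide k u (umin k u)}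

/-- `U^r_{i,w̄c,right}`. -/
def USetNWCR (k r : ℕ) (i : ℤ) : Set (Word k) :=
  {u ∈ USet k r i | ¬IsWeakConnected k u ∧ OnRightSide k u (umin k u)}

/-! ## The algebras `𝒜_k`, `ℋ_k`, `𝒩_k` -/

/-- The defining relations of `𝒜_k`. -/
inductive AkRel (k : ℕ) : FreeAlgebra ℤ (Idx k) → FreeAlgebra ℤ (Idx k) → Prop
  | braid (i : Idx k) :
      AkRel k (FreeAlgebra.ι ℤ i * FreeAlgebra.ι ℤ (i + 1) * FreeAlgebra.ι ℤ i)
        (FreeAlgebra.ι ℤ (i + 1) * FreeAlgebra.ι ℤ i * FreeAlgebra.ι ℤ (i + 1))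
  | comm (i j : Idx k) (h1 : i - j ≠ 1) (h2 : j - i ≠ 1) :
      AkRel k (FreeAlgebra.ι ℤ i * FreeAlgebra.ι ℤ j)
        (FreeAlgebra.ι ℤ j * FreeAlgebra.ι ℤ i)

/-- The algebra `𝒜_k`. -/
abbrev Ak (k : ℕ) := RingQuot (AkRel k)

/-- The generator `A_i` of `𝒜_k`. -/
def Agen (k : ℕ) (i : Idx k) : Ak k := RingQuot.mkAlgHom ℤ (AkRel k) (FreeAlgebra.ι ℤ i)

/-- The element `A_{i₁} ⋯ A_{i_m}` of `𝒜_k` associated to a word. -/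
def Aword (k : ℕ) (u : Word k) : Ak k := (u.map (Agen k)).prod

/-- The defining relations of the 0-Hecke algebra `ℋ_k`. -/
inductive HkRel (k : ℕ) : FreeAlgebra ℤ (Idx k) → FreeAlgebra ℤ (Idx k) → Prop
  | braid (i : Idx k) :
      HkRel k (FreeAlgebra.ι ℤ i * FreeAlgebra.ι ℤ (i + 1) * FreeAlgebra.ι ℤ i)
        (FreeAlgebra.ι ℤ (i + 1) * FreeAlgebra.ι ℤ i * FreeAlgebra.ι ℤ (i + 1))
  | comm (i j : Idx k) (h1 : i - j ≠ 1) (h2 : j - i ≠ 1) :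
      HkRel k (FreeAlgebra.ι ℤ i * FreeAlgebra.ι ℤ j)
        (FreeAlgebra.ι ℤ j * FreeAlgebra.ι ℤ i)
  | sq (i : Idx k) :
      HkRel k (FreeAlgebra.ι ℤ i * FreeAlgebra.ι ℤ i) (-(FreeAlgebra.ι ℤ i))

/-- The 0-Hecke algebra `ℋ_k`. -/
abbrev Hk (k : ℕ) := RingQuot (HkRel k)

/-- The generator `H_i`. -/
def Hgen (k : ℕ) (i : Idx k) : Hk k := RingQuot.mkAlgHom ℤ (HkRel k) (FreeAlgebra.ι ℤ i)

/-- The element `H_{i₁} ⋯ H_{i_m}`. -/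
def Hword (k : ℕ) (u : Word k) : Hk k := (u.map (Hgen k)).prod

/-- The defining relations of the nilCoxeter algebra `𝒩_k`. -/
inductive NkRel (k : ℕ) : FreeAlgebra ℤ (Idx k) → FreeAlgebra ℤ (Idx k) → Prop
  | braid (i : Idx k) :
      NkRel k (FreeAlgebra.ι ℤ i * FreeAlgebra.ι ℤ (i + 1) * FreeAlgebra.ι ℤ i)
        (FreeAlgebra.ι ℤ (i + 1) * FreeAlgebra.ι ℤ i * FreeAlgebra.ι ℤ (i + 1))
  | comm (i j : Idx k) (h1 : i - j ≠ 1) (h2 : j - i ≠ 1) :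
      NkRel k (FreeAlgebra.ι ℤ i * FreeAlgebra.ι ℤ j)
        (FreeAlgebra.ι ℤ j * FreeAlgebra.ι ℤ i)
  | sq (i : Idx k) :
      NkRel k (FreeAlgebra.ι ℤ i * FreeAlgebra.ι ℤ i) 0

/-- The nilCoxeter algebra `𝒩_k`. -/
abbrev Nk (k : ℕ) := RingQuot (NkRel k)

/-- The generator `N_i`. -/
def Ngen (k : ℕ) (i : Idx k) : Nk k := RingQuot.mkAlgHom ℤ (NkRel k) (FreeAlgebra.ι ℤ i)

/-- The element `N_{i₁} ⋯ N_{i_m}`. -/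
def Nword (k : ℕ) (u : Word k) : Nk k := (u.map (Ngen k)).prod

/-! ## The affine symmetric group -/

/-- The relators of the affine symmetric group `S̃_{k+1}`. -/
def CoxRels (k : ℕ) : Set (FreeGroup (Idx k)) :=
  {g | (∃ i : Idx k, g = FreeGroup.of i * FreeGroup.of i) ∨
    (∃ i : Idx k,
      g = FreeGroup.of i * FreeGroup.of (i + 1) * FreeGroup.of i *
        (FreeGroup.of (i + 1) * FreeGroup.of i * FreeGroup.of (i + 1))⁻¹) ∨
    (∃ i j : Idx k, i - j ≠ 1 ∧ j - i ≠ 1 ∧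
      g = FreeGroup.of i * FreeGroup.of j * (FreeGroup.of j * FreeGroup.of i)⁻¹)}

/-- The affine symmetric group `S̃_{k+1}`. -/
abbrev AffS (k : ℕ) := PresentedGroup (CoxRels k)

/-- The generator `s_i`. -/
def sgen (k : ℕ) (i : Idx k) : AffS k := PresentedGroup.of i

/-- The product `s_{i₁} ⋯ s_{i_m}`. -/
def sword (k : ℕ) (u : Word k) : AffS k := (u.map (sgen k)).prod

/-- The Coxeter length of `w ∈ S̃_{k+1}`. -/
def len (k : ℕ) (w : AffS k) : ℕ :=
  sInf {m | ∃ u : Word k, u.length = m ∧ sword k u = w}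

/-- `u` is a reduced word. -/
def IsReducedWord (k : ℕ) (u : Word k) : Prop := len k (sword k u) = u.length

/-- The finite symmetric group `S_{k+1} = ⟨s_1, …, s_k⟩` inside `S̃_{k+1}`. -/
def FinSub (k : ℕ) : Subgroup (AffS k) :=
  Subgroup.closure {g | ∃ i : Idx k, i ≠ 0 ∧ g = sgen k i}

/-- `w` is a minimal-length coset representative of `S̃_{k+1}/S_{k+1}` (a Grassmannian
element). -/
def IsGrassmannian (k : ℕ) (w : AffS k) : Prop :=
  ∀ v : AffS k, w⁻¹ * v ∈ FinSub k → len k w ≤ len k v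

/-! ## Anti-weak hook words -/

/-- Anti-weak hook word, first form: `i₁ < ⋯ < i_j > i_{j+1} > ⋯ > i_m`. -/
def IsAntiHookV (k : ℕ) (u : Word k) : Prop :=
  supp k u ≠ Finset.univ ∧
    ∃ (ds as : List ℕ) (v : ℕ),
      posList k u = ds ++ v :: as ∧
        List.Chain' (· < ·) (ds ++ [v]) ∧ List.Chain' (· > ·) (v :: as)

/-- Anti-weak hook word, second form: `i₁ < ⋯ < i_j = i_{j+1} > ⋯ > i_m`. -/
def IsAntiHookU (k : ℕ) (u : Word k) : Prop :=
  supp k u ≠ Finset.univ ∧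
    ∃ (ds as : List ℕ) (v : ℕ),
      posList k u = ds ++ v :: v :: as ∧
        List.Chain' (· < ·) (ds ++ [v]) ∧ List.Chain' (· > ·) (v :: as)

/-- Anti-weak hook word. -/
def IsAntiWeakHook (k : ℕ) (u : Word k) : Prop := IsAntiHookV k u ∨ IsAntiHookU k u

/-- Length of the maximal strictly increasing (w.r.t. `I_{supp u}`) initial segment of `u`
(= the left side of an anti-weak hook word). -/
def incPrefixLen (k : ℕ) (u : Word k) : ℕ :=
  sSup {n | n ≤ u.length ∧
    List.Chain' (fun a b => pos k (supp k u) a < pos k (supp k u) b) (u.take n)}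

/-- Length of the maximal strictly increasing (w.r.t. `I_{supp u}`) final segment of `u`
(= the right side of a weak hook word). -/
def incSuffixLen (k : ℕ) (u : Word k) : ℕ :=
  sSup {n | n ≤ u.length ∧
    List.Chain' (fun a b => pos k (supp k u) a < pos k (supp k u) b)
      (u.drop (u.length - n))}

/-! ## Noncommutative symmetric functions in `𝒜_k` -/

/-- The word underlying the cyclically decreasing element `d_A` (letters of `A` in decreasing
position order, so that `A_{i+1}` occurs before `A_i` whenever `i, i+1 ∈ A`). -/
def dwordOf (k : ℕ) (A : Finset (Idx k)) : Word k :=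
  (((A.image (pos k A)).sort (· ≤ ·)).reverse).map fun n => gap k A + 1 + (n : Idx k)

/-- The word underlying the cyclically increasing element `i_A`. -/
def iwordOf (k : ℕ) (A : Finset (Idx k)) : Word k :=
  ((A.image (pos k A)).sort (· ≤ ·)).map fun n => gap k A + 1 + (n : Idx k)

/-- The noncommutative homogeneous symmetric function `h_r = Σ_{|A| = r} d_A`. -/
def hFun (k r : ℕ) : Ak k :=
  ∑ A ∈ Finset.powersetCard r (Finset.univ : Finset (Idx k)), Aword k (dwordOf k A)

/-- The noncommutative elementary symmetric function `e_r = Σ_{|A| = r} i_A`. -/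
def eFun (k r : ℕ) : Ak k :=
  ∑ A ∈ Finset.powersetCard r (Finset.univ : Finset (Idx k)), Aword k (iwordOf k A)

/-- The noncommutative hook Schur function `s_{(r−i,1^i)}`. -/
def sHookFun (k r i : ℕ) : Ak k :=
  ∑ j ∈ Finset.range (i + 1), ((-1 : ℤ) ^ j) • (hFun k (r - i + j) * eFun k (i - j))

/-- The noncommutative power sum `p_r`. -/
def pFun (k r : ℕ) : Ak k :=
  ∑ i ∈ Finset.range r, ((-1 : ℤ) ^ i) • sHookFun k r i

/-! ## Actions on the affine symmetric group -/

/-- The star action of a generator: `A_i * w = s_i w` if `l(s_i w) > l(w)`, else `w`. -/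
def starG (k : ℕ) (i : Idx k) (w : AffS k) : AffS k :=
  if len k w < len k (sgen k i * w) then sgen k i * w else w

/-- The star action of a word: `A_{i₁}⋯A_{i_m} * w = A_{i₁} * (⋯ * (A_{i_m} * w))`. -/
def starW (k : ℕ) (u : Word k) (w : AffS k) : AffS k := u.foldr (starG k) w

/-- The dot action of a generator, with values in `S̃_{k+1} ∪ {0}`. -/
def dotG (k : ℕ) (i : Idx k) : Option (AffS k) → Option (AffS k)
  | none => none
  | some w => if len k w < len k (sgen k i * w) then some (sgen k i * w) else none

/-- The dot action of a word. -/
def dotW (k : ℕ) (u : Word k) (o : Option (AffS k)) : Option (AffS k) :=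
  u.foldr (dotG k) o

/-- Extension of an action datum `act : generator → S̃ → S̃ ∪ {0}` to `S̃ ∪ {0}`. -/
def actExt (k : ℕ) (act : Idx k → AffS k → Option (AffS k)) (i : Idx k) :
    Option (AffS k) → Option (AffS k)
  | none => none
  | some w => act i w

/-- Extension of an action datum to words. -/
def actW (k : ℕ) (act : Idx k → AffS k → Option (AffS k)) (u : Word k)
    (o : Option (AffS k)) : Option (AffS k) :=
  u.foldr (actExt k act) o

/-! ## Rings and coefficients -/

/-- `(−1)^n` for an integer exponent `n`, in any ring. -/
def msign (R : Type*) [Ring R] (n : ℤ) : R := (((-1 : Rˣ) ^ n : Rˣ) : R)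

/-- The power sum `p^R_r = Σ_{i=0}^{r−1} Σ_{j=0}^{i} (−1)^{i+j} h^R_{r−i+j} e^R_{i−j}` built from
Pieri data in a commutative ring. -/
def pR {R : Type*} [CommRing R] (h e : ℕ → R) (r : ℕ) : R :=
  ∑ i ∈ Finset.range r, ∑ j ∈ Finset.range (i + 1),
    ((-1 : ℤ) ^ (i + j)) • (h (r - i + j) * e (i - j))

/-- The integer coefficient
`Σ_{i=0}^{r−1} (−1)^i |V^r_{i,wc} ∩ P| + Σ_{i=1}^{r−1} (−1)^i (r−i) |U^r_{i−1,wc} ∩ P|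
 + Σ_{i=1}^{r−2} (−1)^i |U^r_{i−1,w̄c,left} ∩ P|`. -/
def MNcoeff (k r : ℕ) (P : Word k → Prop) : ℤ :=
  (∑ i ∈ Finset.range r, (-1 : ℤ) ^ i * ({u ∈ VSetWC k r (i : ℤ) | P u}.ncard : ℤ)) +
    (∑ i ∈ Finset.Icc 1 (r - 1),
      (-1 : ℤ) ^ i * ((r : ℤ) - i) * ({u ∈ USetWC k r ((i : ℤ) - 1) | P u}.ncard : ℤ)) +
    ∑ i ∈ Finset.Icc 1 (r - 2),
      (-1 : ℤ) ^ i * ({u ∈ USetNWCL k r ((i : ℤ) - 1) | P u}.ncard : ℤ)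

/-- The integer coefficient `Σ_{i=0}^{r−1} (−1)^i |V^r_{i,c} ∩ P|`. -/
def kcoeff (k r : ℕ) (P : Word k → Prop) : ℤ :=
  ∑ i ∈ Finset.range r, (-1 : ℤ) ^ i * ({u ∈ VSetC k r (i : ℤ) | P u}.ncard : ℤ)

/-! ## Partitions, cores, bounded partitions -/

/-- A cell of a Young diagram: (row, column), `0`-indexed. -/
abbrev Cell := ℕ × ℕ

/-- A (finite) Young diagram, as a finite lower set of cells. -/
def IsYoung (S : Set Cell) : Prop :=
  S.Finite ∧ ∀ p ∈ S, ∀ q : Cell, q.1 ≤ p.1 → q.2 ≤ p.2 → q ∈ S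

/-- The `(k+1)`-residue of a cell `(i,j)`, i.e. `j − i mod (k+1)`. -/
def res (k : ℕ) (c : Cell) : Idx k := (c.2 : Idx k) - (c.1 : Idx k)

/-- The hook length of a cell: arm + leg + 1. -/
def hookLen (S : Set Cell) (c : Cell) : ℕ :=
  {j | c.2 < j ∧ (c.1, j) ∈ S}.ncard + {i | c.1 < i ∧ (i, c.2) ∈ S}.ncard + 1

/-- A `(k+1)`-core: a partition with no cell of hook length `k+1`. -/
def IsCore (k : ℕ) (S : Set Cell) : Prop :=
  IsYoung S ∧ ∀ c ∈ S, hookLen S c ≠ k + 1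

/-- A `k`-bounded partition: every part is at most `k`. -/
def IsBounded (k : ℕ) (S : Set Cell) : Prop :=
  IsYoung S ∧ ∀ c ∈ S, c.2 < k

/-- A removable corner of `S`. -/
def Removable (S : Set Cell) (c : Cell) : Prop :=
  c ∈ S ∧ (c.1 + 1, c.2) ∉ S ∧ (c.1, c.2 + 1) ∉ S

/-- An addable corner of `S`: a cell not in `S` whose addition yields a partition. -/
def Addable (S : Set Cell) (c : Cell) : Prop :=
  c ∉ S ∧ IsYoung (S ∪ {c})

/-- The map `𝔭` from `(k+1)`-cores to `k`-bounded partitions: row `i` of `𝔭(κ)` has as many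
cells as there are cells of hook length at most `k` in row `i` of `κ`. -/
def pMap (k : ℕ) (S : Set Cell) : Set Cell :=
  {c | c.2 < {j | (c.1, j) ∈ S ∧ hookLen S (c.1, j) ≤ k}.ncard}

/-- The inverse bijection `𝔭^{-1}` from `k`-bounded partitions to `(k+1)`-cores. -/
def pInv (k : ℕ) (lam : Set Cell) : Set Cell :=
  Function.invFunOn (pMap k) {S | IsCore k S} lam

/-- The transpose (conjugate) of a diagram. -/
def transposeSet (S : Set Cell) : Set Cell := {c | (c.2, c.1) ∈ S}

/-- The `k`-conjugate `λ^{(k)} = 𝔭((𝔭^{-1} λ)^t)`. -/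
def kconj (k : ℕ) (lam : Set Cell) : Set Cell := pMap k (transposeSet (pInv k lam))

/-- A skew shape is a ribbon if it contains no `2×2` square. -/
def IsRibbon (D : Set Cell) : Prop :=
  ∀ c : Cell, ¬((c.1, c.2) ∈ D ∧ (c.1 + 1, c.2) ∈ D ∧
    (c.1, c.2 + 1) ∈ D ∧ (c.1 + 1, c.2 + 1) ∈ D)

/-- A vertical strip: no two cells in the same row. -/
def IsVStrip (D : Set Cell) : Prop :=
  ∀ c ∈ D, ∀ c' ∈ D, c.1 = c'.1 → c = c'

/-- A horizontal strip: no two cells in the same column. -/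
def IsHStrip (D : Set Cell) : Prop :=
  ∀ c ∈ D, ∀ c' ∈ D, c.2 = c'.2 → c = c'

/-- The height of a skew shape: the number of occupied rows minus the number of connected
components; each connected component is counted by its unique last occupied row, i.e. an
occupied row sharing no column with the next row. -/
def htSkew (D : Set Cell) : ℕ :=
  {i : ℕ | ∃ j, (i, j) ∈ D}.ncard -
    {i : ℕ | (∃ j, (i, j) ∈ D) ∧ ¬∃ j, (i, j) ∈ D ∧ (i + 1, j) ∈ D}.ncard

/-- The set of `(k+1)`-residues of the cells of a skew shape. -/
def residSupp (k : ℕ) (D : Set Cell) : Finset (Idx k) :=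
  Set.Finite.toFinset (Set.toFinite (res k '' D))

/-! ## Star and dot actions on cores and on `k`-bounded partitions -/

/-- The star action of `A_i` on `(k+1)`-cores together with `0`. -/
def starC (k : ℕ) (i : Idx k) : Option (Set Cell) → Option (Set Cell)
  | none => none
  | some S =>
    if ∃ c, Addable S c ∧ res k c = i then some (S ∪ {c | Addable S c ∧ res k c = i})
    else if ∃ c, Removable S c ∧ res k c = i then some S
    else none

/-- The star action of a word on cores. -/
def starCW (k : ℕ) (u : Word k) (o : Option (Set Cell)) : Option (Set Cell) :=
  u.foldr (starC k) o

/-- The star action of a word on `k`-bounded partitions, transported through `𝔭`. -/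
def starB (k : ℕ) (u : Word k) (lam : Set Cell) : Option (Set Cell) :=
  (starCW k u (some (pInv k lam))).map (pMap k)

/-- The dot action of `A_i` on `(k+1)`-cores together with `0`. -/
def dotC (k : ℕ) (i : Idx k) : Option (Set Cell) → Option (Set Cell)
  | none => none
  | some S =>
    if ∃ c, Addable S c ∧ res k c = i then some (S ∪ {c | Addable S c ∧ res k c = i})
    else none

/-- The dot action of a word on cores. -/
def dotCW (k : ℕ) (u : Word k) (o : Option (Set Cell)) : Option (Set Cell) :=
  u.foldr (dotC k) o

/-- The dot action of a word on `k`-bounded partitions, transported through `𝔭`. -/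
def dotB (k : ℕ) (u : Word k) (lam : Set Cell) : Option (Set Cell) :=
  (dotCW k u (some (pInv k lam))).map (pMap k)

/-- The number of maximal segments of consecutive letters (w.r.t. the positions for `S`) of a
word `V`. -/
def numSegments (k : ℕ) (S : Finset (Idx k)) (V : Word k) : ℕ :=
  if V.length = 0 then 0
  else ((V.zip V.tail).countP fun p => decide (pos k S p.2 ≠ pos k S p.1 + 1)) + 1

/-- Conditions (K0)–(K4) of the Murnaghan–Nakayama rule for `K`-`k`-Schur functions. -/
def Kconds (k r : ℕ) (lam mu : Set Cell) : Prop :=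
  lam ⊆ mu ∧ kconj k lam ⊆ kconj k mu ∧
    (mu \ lam).ncard ≤ r ∧
    IsRibbon (pInv k mu \ pInv k lam) ∧
    (IsKConnectedSet k (residSupp k (pInv k mu \ pInv k lam)) ∨
      (residSupp k (pInv k mu \ pInv k lam)).card < r) ∧
    htSkew (mu \ lam) + htSkew (kconj k mu \ kconj k lam) < r

/-- Conditions (k0)–(k4) of the Murnaghan–Nakayama rule for `k`-Schur functions. -/
def kconds (k r : ℕ) (lam mu : Set Cell) : Prop :=
  lam ⊆ mu ∧ kconj k lam ⊆ kconj k mu ∧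
    (mu \ lam).ncard = r ∧
    IsRibbon (pInv k mu \ pInv k lam) ∧
    IsKConnectedSet k (residSupp k (pInv k mu \ pInv k lam)) ∧
    htSkew (mu \ lam) + htSkew (kconj k mu \ kconj k lam) = r - 1


theorem star_cell (k : ℕ) (κ : Set Cell) (c : Cell) (hc : c ∉ κ) (u : Word k) :
    ∀ π : Set Cell, starCW k u (some κ) = some π → c ∈ π →
      ∃ (p q : Word k) (S : Set Cell), u = p ++ res k c :: q ∧
        starCW k q (some κ) = some S ∧ Addable S c := by
  induction u with
  | nil =>
    intro π h hcπ
    simp only [starCW, List.foldr_nil, Option.some.injEq] at h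
    exact absurd (h ▸ hcπ) hc
  | cons x q ih =>
    intro π h hcπ
    have h' : starC k x (starCW k q (some κ)) = some π := h
    have key : ∀ S, starCW k q (some κ) = some S → c ∈ S →
        ∃ (p q' : Word k) (S : Set Cell), x :: q = p ++ res k c :: q' ∧
        starCW k q' (some κ) = some S ∧ Addable S c := by
      intro S hS hcS
      obtain ⟨p, q', S', h1, h2, h3⟩ := ih S hS hcS
      exact ⟨x :: p, q', S', by rw [h1]; rfl, h2, h3⟩
    cases hS : starCW k q (some κ) with
    | none => rw [hS] at h'; simp [starC] at h'
    | some S =>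
      rw [hS] at h'
      simp only [starC] at h'
      split_ifs at h' with h1 h2
      · have e := Option.some.inj h'
        rw [← e] at hcπ
        rcases hcπ with hcS | ⟨ha, hr⟩
        · exact key S hS hcS
        · exact ⟨[], q, S, by rw [hr]; rfl, hS, ha⟩
      · have e := Option.some.inj h'
        rw [← e] at hcπ
        exact key S hS hcπ

theorem valley (ds as : List ℕ) (v a b : ℕ) (hab : a < b)
    (h1 : List.Chain' (· > ·) (ds ++ [v])) (h2 : List.Chain' (· < ·) (v :: as))
    (h : [a, b, a].Sublist (ds ++ v :: v :: as)) : False := by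
  have h1 := List.isChain_iff_pairwise.1 h1
  have h2 := List.isChain_iff_pairwise.1 h2
  have e : ds ++ v :: v :: as = (ds ++ [v]) ++ (v :: as) := by simp
  rw [e, List.sublist_append_iff] at h
  obtain ⟨l1, l2, he, hl1, hl2⟩ := h
  have p1 := h1.sublist hl1
  have p2 := h2.sublist hl2
  match l1, he with
  | [], he => simp only [List.nil_append] at he; subst he; simp at p2 <;> omega
  | [x], he =>
    simp only [List.cons_append, List.nil_append, List.cons.injEq] at he
    obtain ⟨_, rfl⟩ := he; simp at p2 <;> omega
  | x :: y :: l, he =>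
    simp only [List.cons_append, List.cons.injEq] at he
    obtain ⟨rfl, rfl, _⟩ := he
    simp at p1; omega

theorem gap_notMem (k : ℕ) (S : Finset (Idx k)) (hS : S ≠ Finset.univ) : gap k S ∉ S := by
  have hex : ∃ m : ℕ, m ≤ k ∧ (m : Idx k) ∉ S := by
    by_contra hcon
    push Not at hcon
    apply hS
    rw [Finset.eq_univ_iff_forall]
    intro x
    have := hcon x.val (Nat.lt_succ_iff.1 (ZMod.val_lt x))
    rwa [ZMod.natCast_zmod_val] at this
  unfold gap gapNat
  rw [dif_pos hex]
  exact (Nat.find_spec hex).2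

theorem pos_succ_lt (k : ℕ) (hk : 1 ≤ k) (S : Finset (Idx k)) (hS : S ≠ Finset.univ)
    (i : Idx k) (hi : i ∈ S) : pos k S i < pos k S (i + 1) := by
  have hne : i - gap k S ≠ 0 := by
    intro h
    exact gap_notMem k S hS (sub_eq_zero.1 h ▸ hi)
  have : Fact (1 < k + 1) := ⟨by omega⟩
  have h1 : (i - gap k S - 1).val < (i - gap k S).val := by
    have hv : 1 ≤ (i - gap k S).val :=
      Nat.one_le_iff_ne_zero.2 (fun h => hne ((ZMod.val_eq_zero _).1 h))
    have := ZMod.val_sub (a := i - gap k S) (b := 1) (by rwa [ZMod.val_one])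
    rw [this, ZMod.val_one]; omega
  unfold pos
  have e : i + 1 - gap k S - 1 = i - gap k S := by ring
  rw [e]; exact h1

theorem statement13 (k : ℕ) (hk : 1 ≤ k) (κ : Set Cell) (hκ : IsCore k κ)
    (u : Word k) (hu : IsWeakHook k u) (π : Set Cell)
    (hπ : starCW k u (some κ) = some π) :
    IsRibbon (π \ κ) := by
  rintro ⟨r, c⟩ ⟨⟨_, a2⟩, _, ⟨_, b2⟩, c1, c2⟩
  dsimp only at *
  have main : ∀ h : supp k u ≠ Finset.univ, ∃ a b : ℕ, a < b ∧
      [a, b, a].Sublist (posList k u) := by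
    intro hs
    obtain ⟨p1, q1, S1, e1, f1, g1⟩ := star_cell k κ _ c2 u π hπ c1
    have m1 : (r, c + 1) ∈ S1 := by
      have := g1.2.2 (r + 1, c + 1) (Or.inr rfl) (r, c + 1) (by simp) (by simp)
      rcases this with h | h
      · exact h
      · simp at h
    obtain ⟨p2, q2, S2, e2, f2, g2⟩ := star_cell k κ _ b2 q1 S1 f1 m1
    have m2 : (r, c) ∈ S2 := by
      have := g2.2.2 (r, c + 1) (Or.inr rfl) (r, c) (by simp) (by simp)
      rcases this with h | h
      · exact h
      · simp at h
    obtain ⟨p3, q3, S3, e3, f3, g3⟩ := star_cell k κ _ a2 q2 S2 f2 m2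
    have r1 : res k (r + 1, c + 1) = res k (r, c) := by simp [res]
    have r2 : res k (r, c + 1) = res k (r, c) + 1 := by simp [res]; ring
    rw [r1] at e1
    rw [r2] at e2
    generalize res k (r, c) = i at *
    have hi : i ∈ supp k u := by rw [supp, List.mem_toFinset, e1]; simp
    refine ⟨_, _, pos_succ_lt k hk (supp k u) hs i hi, ?_⟩
    have hsub : [i, i + 1, i].Sublist u := by
      have s3 : [i].Sublist q2 := by rw [e3]; simp
      have s2 : [i + 1, i].Sublist q1 := by
        rw [e2]; exact (s3.cons_cons _).trans (List.sublist_append_right _ _)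
      rw [e1]
      exact (s2.cons_cons _).trans (List.sublist_append_right _ _)
    exact hsub.map (pos k (supp k u))
  rcases hu with ⟨hs, ds, as, v, hp, h1, h2⟩ | ⟨hs, ds, as, v, hp, h1, h2⟩
  · obtain ⟨a, b, hab, h⟩ := main hs
    rw [hp] at h
    exact valley ds as v a b hab h1 h2
      (h.trans ((List.sublist_cons_self _ _).append_left _))
  · obtain ⟨a, b, hab, h⟩ := main hs
    rw [hp] at h
    exact valley ds as v a b hab h1 h2 h

end MN

end
end

section
/- Let u = A_{i_1}⋯A_{i_r} be a weak hook word with i_1 > ⋯ > i_j ≤ i_{j+1} < ⋯ < i_r with respect to I_{supp(u)}, and write u = H V with H = A_{i_1}⋯A_{i_j} and V = A_{i_{j+1}}⋯A_{i_r}. Let κ be a (k+1)-core with u * κ ≠ 0 under the star action. Then (V * κ)/κ is a vertical strip and (u * κ)/(V * κ) is a horizontal strip. -/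
open scoped BigOperators Classical

noncomputable section

namespace MN

theorem gap_not_mem (k : ℕ) (S : Finset (Idx k)) (h : S ≠ Finset.univ) : gap k S ∉ S := by
  have hex : ∃ m : ℕ, m ≤ k ∧ (m : Idx k) ∉ S := by
    by_contra hc
    push Not at hc
    apply h
    ext x
    simp only [Finset.mem_univ, iff_true]
    have := hc x.val (Nat.lt_succ_iff.mp (ZMod.val_lt x))
    rwa [ZMod.natCast_zmod_val] at this
  unfold gap gapNat
  rw [dif_pos hex]
  exact (Nat.find_spec hex).2

theorem pos_lt_gap (k : ℕ) (S : Finset (Idx k)) (j : Idx k)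
    (h : pos k S j < pos k S (j - 1)) : j - 1 = gap k S := by
  unfold pos at h
  by_contra hne
  have h0 : j - gap k S - 1 ≠ 0 := fun h0 => hne (by linear_combination h0)
  have h1 : 1 ≤ (j - gap k S - 1).val :=
    Nat.one_le_iff_ne_zero.mpr (fun h' => h0 ((ZMod.val_eq_zero _).mp h'))
  have hlt : (j - gap k S - 1).val < k + 1 := ZMod.val_lt _
  have : (j - 1 - gap k S - 1) = (((j - gap k S - 1).val - 1 : ℕ) : ZMod (k + 1)) := by
    rw [Nat.cast_sub h1, ZMod.natCast_zmod_val]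
    push_cast
    ring
  rw [this, ZMod.val_natCast, Nat.mod_eq_of_lt (by omega)] at h
  omega

/-- Lower sets of cells. -/
def Low (S : Set Cell) : Prop := ∀ p ∈ S, ∀ q : Cell, q.1 ≤ p.1 → q.2 ≤ p.2 → q ∈ S

theorem starC_some (k : ℕ) (i : Idx k) (o : Option (Set Cell)) (T : Set Cell)
    (h : starC k i o = some T) :
    ∃ S, o = some S ∧ S ⊆ T ∧ ∀ c ∈ T, c ∉ S → Addable S c ∧ res k c = i := by
  cases o with
  | none => simp [starC] at h
  | some S =>
    refine ⟨S, rfl, ?_⟩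
    unfold starC at h
    simp only at h
    split_ifs at h with h1 h2
    · obtain rfl := Option.some.inj h
      refine ⟨Set.subset_union_left, ?_⟩
      rintro c (hc | hc) hn
      · exact absurd hc hn
      · exact hc
    · obtain rfl := Option.some.inj h
      exact ⟨le_rfl, fun c hc hn => absurd hc hn⟩

theorem add_mem {S : Set Cell} {c q : Cell} (h : Addable S c) (h1 : q.1 ≤ c.1) (h2 : q.2 ≤ c.2)
    (hne : q ≠ c) : q ∈ S := by
  rcases h.2.2 c (Or.inr rfl) q h1 h2 with hq | hq
  · exact hq
  · exact absurd hq hne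

theorem starCW_basic (k : ℕ) (κ : Set Cell) (hκ : Low κ) (W : Word k) :
    ∀ T, starCW k W (some κ) = some T →
      Low T ∧ ∀ c ∈ T, c ∉ κ → res k c ∈ W := by
  induction W with
  | nil =>
    intro T h
    obtain rfl := Option.some.inj h
    exact ⟨hκ, fun c hc hn => absurd hc hn⟩
  | cons i W ih =>
    intro T h
    obtain ⟨S, hS, hST, hT⟩ := starC_some k i _ T h
    obtain ⟨hl, hr⟩ := ih S hS
    constructor
    · intro p hp q h1 h2
      by_cases hpS : p ∈ S
      · exact hST (hl p hpS q h1 h2)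
      · by_cases hqp : q = p
        · exact hqp ▸ hp
        · exact hST (add_mem (hT p hp hpS).1 h1 h2 hqp)
    · intro c hc hn
      by_cases hcS : c ∈ S
      · exact List.mem_cons_of_mem _ (hr c hcS hn)
      · rw [(hT c hc hcS).2]
        exact List.mem_cons_self

theorem res_right (k x y : ℕ) : res k (x, y) = res k (x, y + 1) - 1 := by
  simp only [res]; push_cast; ring

theorem res_down (k x y : ℕ) : res k (x + 1, y) = res k (x, y) - 1 := by
  simp only [res]; push_cast; ring

theorem vadj (k : ℕ) (R : Finset (Idx k)) (hR : gap k R ∉ R) (κ : Set Cell) (hκ : Low κ)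
    (W : Word k) : (∀ a ∈ W, a ∈ R) → W.Pairwise (fun a b => pos k R a < pos k R b) →
    ∀ T, starCW k W (some κ) = some T →
      ∀ x y, (x, y) ∈ T → (x, y) ∉ κ → (x, y + 1) ∉ T := by
  induction W with
  | nil =>
    intro _ _ T h x y hm hn
    obtain rfl := Option.some.inj h
    exact absurd hm hn
  | cons i W ih =>
    intro hW hP T h x y hm hn hm1
    obtain ⟨S, hS, hST, hT⟩ := starC_some k i _ T h
    obtain ⟨hl, hr⟩ := starCW_basic k κ hκ W S hS
    rw [List.pairwise_cons] at hP
    have hxy : (x, y) ∈ S := by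
      by_cases h1 : (x, y + 1) ∈ S
      · exact hl _ h1 _ le_rfl (Nat.le_succ _)
      · exact add_mem (hT _ hm1 h1).1 le_rfl (Nat.le_succ _) (by simp)
    by_cases h1 : (x, y + 1) ∈ S
    · exact ih (fun a ha => hW a (List.mem_cons_of_mem _ ha)) hP.2 S hS x y hxy hn h1
    · have h2 := hr _ hxy hn
      rw [res_right, (hT _ hm1 h1).2] at h2
      have h3 := pos_lt_gap k R i (hP.1 _ h2)
      exact hR (h3 ▸ hW _ (List.mem_cons_of_mem _ h2))

theorem hadj (k : ℕ) (R : Finset (Idx k)) (hR : gap k R ∉ R) (κ : Set Cell) (hκ : Low κ)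
    (W : Word k) : (∀ a ∈ W, a ∈ R) → W.Pairwise (fun a b => pos k R b < pos k R a) →
    ∀ T, starCW k W (some κ) = some T →
      ∀ x y, (x, y) ∈ T → (x, y) ∉ κ → (x + 1, y) ∉ T := by
  induction W with
  | nil =>
    intro _ _ T h x y hm hn
    obtain rfl := Option.some.inj h
    exact absurd hm hn
  | cons i W ih =>
    intro hW hP T h x y hm hn hm1
    obtain ⟨S, hS, hST, hT⟩ := starC_some k i _ T h
    obtain ⟨hl, hr⟩ := starCW_basic k κ hκ W S hS
    rw [List.pairwise_cons] at hP
    have hxy : (x, y) ∈ S := by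
      by_cases h1 : (x + 1, y) ∈ S
      · exact hl _ h1 _ (Nat.le_succ _) le_rfl
      · exact add_mem (hT _ hm1 h1).1 (Nat.le_succ _) le_rfl (by simp)
    by_cases h1 : (x + 1, y) ∈ S
    · exact ih (fun a ha => hW a (List.mem_cons_of_mem _ ha)) hP.2 S hS x y hxy hn h1
    · have h2 := hr _ hxy hn
      have h4 := (hT _ hm1 h1).2
      rw [res_down] at h4
      have h3 := hP.1 _ h2
      rw [← h4] at h3
      have h5 := pos_lt_gap k R _ h3
      rw [h4] at h5
      exact hR (h5 ▸ hW _ List.mem_cons_self)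

theorem statement14 (k : ℕ) (hk : 1 ≤ k) (u H V : Word k)
    (huHV : u = H ++ V) (hu : IsWeakHook k u)
    (hH : List.Chain' (fun a b => pos k (supp k u) b < pos k (supp k u) a) H)
    (hV : List.Chain' (fun a b => pos k (supp k u) a < pos k (supp k u) b) V)
    (hmid : ∀ a ∈ H.getLast?, ∀ b ∈ V.head?, pos k (supp k u) a ≤ pos k (supp k u) b)
    (κ σ π : Set Cell) (hκ : IsCore k κ)
    (hσ : starCW k V (some κ) = some σ) (hπ : starCW k u (some κ) = some π) :
    IsVStrip (σ \ κ) ∧ IsHStrip (π \ σ) := by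
  have hne : supp k u ≠ Finset.univ := by
    rcases hu with h | h <;> exact h.1
  have hg := gap_not_mem k _ hne
  have hl : Low κ := hκ.1.2
  have hlσ := (starCW_basic k κ hl V σ hσ).1
  have hπ' : starCW k H (some σ) = some π := by
    rw [← hσ, ← hπ, huHV]
    simp [starCW, List.foldr_append]
  have hlπ := (starCW_basic k σ hlσ H π hπ').1
  have hVm : ∀ a ∈ V, a ∈ supp k u := by
    intro a ha
    simp [supp, huHV, ha]
  have hHm : ∀ a ∈ H, a ∈ supp k u := by
    intro a ha
    simp [supp, huHV, ha]
  have tV : V.Pairwise (fun a b => pos k (supp k u) a < pos k (supp k u) b) := by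
    haveI : IsTrans (Idx k) (fun a b => pos k (supp k u) a < pos k (supp k u) b) :=
      ⟨fun _ _ _ h1 h2 => lt_trans h1 h2⟩
    exact List.isChain_iff_pairwise.mp hV
  have tH : H.Pairwise (fun a b => pos k (supp k u) b < pos k (supp k u) a) := by
    haveI : IsTrans (Idx k) (fun a b => pos k (supp k u) b < pos k (supp k u) a) :=
      ⟨fun _ _ _ h1 h2 => lt_trans h2 h1⟩
    exact List.isChain_iff_pairwise.mp hH
  have kV := vadj k _ hg κ hl V hVm tV σ hσ
  have kH := hadj k _ hg σ hlσ H hHm tH π hπ'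
  constructor
  · rintro ⟨x, y⟩ hc ⟨x', y'⟩ hc' hxx
    simp only at hxx
    subst hxx
    rcases lt_trichotomy y y' with h | h | h
    · exact absurd (hlσ _ hc'.1 (x, y + 1) le_rfl h) (kV x y hc.1 hc.2)
    · rw [h]
    · exact absurd (hlσ _ hc.1 (x, y' + 1) le_rfl h) (kV x y' hc'.1 hc'.2)
  · rintro ⟨x, y⟩ hc ⟨x', y'⟩ hc' hyy
    simp only at hyy
    subst hyy
    rcases lt_trichotomy x x' with h | h | h
    · exact absurd (hlπ _ hc'.1 (x + 1, y) h le_rfl) (kH x y hc.1 hc.2)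
    · rw [h]
    · exact absurd (hlπ _ hc.1 (x' + 1, y) h le_rfl) (kH x' y hc'.1 hc'.2)

end MN

end
end
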